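/- Let α ∈ (0,1) ∪ (1,2), let k be an odd integer and l an integer. Then (1/π) ∫_0^π e^{−2ils} · ( ∫_0^π sin(η)^α·(−k²·sin(η) + 2ik·cos(η))·e^{ikη}·|sin(s−η)|^{1−α} dη ) ds = (i·sgn(k−2l)/8)·α·(1−α)·((1−α)k² − 4kl) · Γ((α−1)/2 + |l|)·Γ((−1−α)/2 + |k−2l|/2) / ( Γ((3−α)/2 + |l|)·Γ((3+α)/2 + |k−2l|/2) ), where for each s ∈ (0,π) the inner integral converges absolutely. -/

import Mathlib

open MeasureTheory Filter Set Real intervalIntegral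

theorem image_one_sub_cos_div_two : (fun x : ℝ => (1 - Real.cos x) / 2) '' Ioo 0 π = Ioo 0 1 := by
  ext y
  constructor
  · rintro ⟨x, ⟨h0, h1⟩, rfl⟩
    have hs := Real.sin_pos_of_pos_of_lt_pi h0 h1
    have := Real.sin_sq_add_cos_sq x
    constructor <;> dsimp only <;> nlinarith
  · rintro ⟨h0, h1⟩
    refine ⟨Real.arccos (1 - 2 * y), ⟨Real.arccos_pos.2 (by linarith), ?_⟩, ?_⟩
    · exact lt_of_le_of_ne (Real.arccos_le_pi _) (fun h => by
        have := Real.arccos_eq_pi.1 h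
        linarith)
    · dsimp only
      rw [Real.cos_arccos (by linarith) (by linarith)]
      ring

theorem hasDerivWithinAt_one_sub_cos_div_two (x : ℝ) (s : Set ℝ) :
    HasDerivWithinAt (fun x : ℝ => (1 - Real.cos x) / 2) (Real.sin x / 2) s x := by
  simpa using (((Real.hasDerivAt_cos x).const_sub 1).div_const 2).hasDerivWithinAt

theorem injOn_one_sub_cos_div_two : InjOn (fun x : ℝ => (1 - Real.cos x) / 2) (Ioo 0 π) := by
  intro x hx y hy h
  exact Real.injOn_cos (Ioo_subset_Icc_self hx) (Ioo_subset_Icc_self hy)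
    (by dsimp only at h; linarith)

theorem abs_deriv_smul_beta_integrand {β x : ℝ} (hx : x ∈ Ioo 0 π) :
    |Real.sin x / 2| • ((((1 - Real.cos x) / 2 : ℝ) : ℂ) ^ (((β + 1) / 2 : ℝ) - 1 : ℂ) *
      (1 - (((1 - Real.cos x) / 2 : ℝ) : ℂ)) ^ (((β + 1) / 2 : ℝ) - 1 : ℂ))
      = ((((2 : ℝ) ^ β)⁻¹ * Real.sin x ^ β : ℝ) : ℂ) := by
  have hs := Real.sin_pos_of_pos_of_lt_pi hx.1 hx.2
  have hsq := Real.sin_sq_add_cos_sq x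
  have h1 : 0 ≤ (1 - Real.cos x) / 2 := by linarith [Real.cos_le_one x]
  have h2 : 0 ≤ 1 - (1 - Real.cos x) / 2 := by linarith [Real.neg_one_le_cos x]
  have e : (((β + 1) / 2 : ℝ) - 1 : ℂ) = (((β - 1) / 2 : ℝ) : ℂ) := by push_cast; ring
  rw [e, ← Complex.ofReal_one, ← Complex.ofReal_sub, ← Complex.ofReal_cpow h1,
    ← Complex.ofReal_cpow h2, ← Complex.ofReal_mul, Complex.real_smul, ← Complex.ofReal_mul,
    ← Real.mul_rpow h1 h2, abs_of_pos (by positivity)]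
  congr 1
  have : (1 - Real.cos x) / 2 * (1 - (1 - Real.cos x) / 2) = (Real.sin x / 2) ^ (2 : ℝ) := by
    rw [Real.rpow_two]; linarith
  rw [this, ← Real.rpow_mul (by positivity), mul_comm, ← Real.rpow_add_one (by positivity),
    show 2 * ((β - 1) / 2) + 1 = β by ring, Real.div_rpow hs.le (by norm_num)]
  ring

theorem intervalIntegrable_sin_rpow {β : ℝ} (hβ : -1 < β) :
    IntervalIntegrable (fun x => Real.sin x ^ β) volume 0 π := by
  have hu : 0 < (((β + 1) / 2 : ℝ) : ℂ).re := by rw [Complex.ofReal_re]; linarith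
  have h := Complex.betaIntegral_convergent hu hu
  rw [intervalIntegrable_iff_integrableOn_Ioo_of_le zero_le_one, ← image_one_sub_cos_div_two,
    integrableOn_image_iff_integrableOn_abs_deriv_smul measurableSet_Ioo
      (fun x _ => hasDerivWithinAt_one_sub_cos_div_two x _) injOn_one_sub_cos_div_two,
    integrableOn_congr_fun (fun x hx => abs_deriv_smul_beta_integrand hx) measurableSet_Ioo] at h
  rw [intervalIntegrable_iff_integrableOn_Ioo_of_le Real.pi_pos.le]
  have h2 : IntegrableOn (fun x => (2 : ℝ) ^ β * (((2 : ℝ) ^ β)⁻¹ * Real.sin x ^ β)) (Ioo 0 π) :=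
    Integrable.const_mul (f := fun x => ((2 : ℝ) ^ β)⁻¹ * Real.sin x ^ β) (Integrable.re h) _
  refine h2.congr_fun (fun x _ => ?_) measurableSet_Ioo
  have : (0 : ℝ) < 2 ^ β := by positivity
  field_simp

theorem integral_sin_rpow {β : ℝ} (hβ : -1 < β) :
    ∫ x in (0 : ℝ)..π, Real.sin x ^ β
      = √π * Real.Gamma ((β + 1) / 2) / Real.Gamma (β / 2 + 1) := by
  have hu' : 0 < (β + 1) / 2 := by linarith
  have hu : 0 < (((β + 1) / 2 : ℝ) : ℂ).re := by rwa [Complex.ofReal_re]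
  have h := Complex.betaIntegral_eq_Gamma_mul_div _ _ hu hu
  rw [Complex.betaIntegral, integral_of_le zero_le_one, integral_Ioc_eq_integral_Ioo,
    ← image_one_sub_cos_div_two,
    integral_image_eq_integral_abs_deriv_smul measurableSet_Ioo
      (fun x _ => hasDerivWithinAt_one_sub_cos_div_two x _) injOn_one_sub_cos_div_two,
    setIntegral_congr_fun measurableSet_Ioo (fun x hx => abs_deriv_smul_beta_integrand hx),
    integral_complex_ofReal, ← Complex.ofReal_add] at h
  simp only [Complex.Gamma_ofReal] at h
  norm_cast at h
  rw [MeasureTheory.integral_const_mul, ← integral_Ioc_eq_integral_Ioo, ← integral_of_le Real.pi_pos.le] at h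
  have hd := Real.Gamma_mul_Gamma_add_half ((β + 1) / 2)
  rw [show (β + 1) / 2 + 1 / 2 = β / 2 + 1 by ring, show 2 * ((β + 1) / 2) = β + 1 by ring,
    show 1 - (β + 1) = -β by ring, Real.rpow_neg (by norm_num)] at hd
  rw [show (β + 1) / 2 + (β + 1) / 2 = β + 1 by ring] at h
  have h1 : 0 < Real.Gamma (β / 2 + 1) := Real.Gamma_pos_of_pos (by linarith)
  have h2 : 0 < Real.Gamma (β + 1) := Real.Gamma_pos_of_pos (by linarith)
  have h3 : 0 < Real.Gamma ((β + 1) / 2) := Real.Gamma_pos_of_pos hu'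
  have h4 : (0 : ℝ) < 2 ^ β := by positivity
  rw [eq_div_iff h1.ne']
  rw [eq_div_iff h2.ne'] at h
  generalize Real.Gamma (β / 2 + 1) = G at h1 hd ⊢
  field_simp at h hd
  have : (Real.Gamma (β + 1) * Real.Gamma ((β + 1) / 2)) *
      ((∫ x in (0 : ℝ)..π, Real.sin x ^ β) * G) =
      (Real.Gamma (β + 1) * Real.Gamma ((β + 1) / 2)) * (√π * Real.Gamma ((β + 1) / 2)) := by
    linear_combination (G * Real.Gamma ((β + 1) / 2)) * h +
       Real.Gamma ((β + 1) / 2) ^ 2 * hd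
  exact mul_left_cancel₀ (by positivity) this

/-- The integral of `sin x ^ β * exp (i m x)` over `[0, π]`. -/
noncomputable def sinPowFourier (β : ℝ) (m : ℤ) : ℂ :=
  ∫ x in (0 : ℝ)..π, ((Real.sin x ^ β : ℝ) : ℂ) * Complex.exp (Complex.I * (m : ℂ) * (x : ℂ))

theorem intervalIntegrable_sin_rpow_mul {β : ℝ} (hβ : -1 < β) {g : ℝ → ℂ} (hg : Continuous g) :
    IntervalIntegrable (fun x => ((Real.sin x ^ β : ℝ) : ℂ) * g x) volume 0 π :=
  IntervalIntegrable.mul_continuousOn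
    ⟨(intervalIntegrable_sin_rpow hβ).1.ofReal, (intervalIntegrable_sin_rpow hβ).2.ofReal⟩
    hg.continuousOn

theorem sin_rpow_add_one {β : ℝ} (hβ : -1 < β) {x : ℝ} (hx : x ∈ Icc 0 π) :
    ((Real.sin x ^ (β + 1) : ℝ) : ℂ) = ((Real.sin x ^ β : ℝ) : ℂ) * (Real.sin x : ℂ) := by
  rw [Real.rpow_add_one' (Real.sin_nonneg_of_mem_Icc hx) (by linarith), Complex.ofReal_mul]

theorem integral_sin_rpow_mul_cos_mul_exp {β : ℝ} (hβ : -1 < β) (m : ℤ) :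
    ((β : ℂ) + 1) * ∫ x in (0 : ℝ)..π, ((Real.sin x ^ β : ℝ) : ℂ) *
        ((Real.cos x : ℂ) * Complex.exp (Complex.I * (m : ℂ) * (x : ℂ)))
      = -(Complex.I * m) * sinPowFourier (β + 1) m := by
  have hi1 := intervalIntegrable_sin_rpow_mul hβ
    (g := fun x => (Real.cos x : ℂ) * Complex.exp (Complex.I * (m : ℂ) * (x : ℂ))) (by fun_prop)
  have hi2 := intervalIntegrable_sin_rpow_mul (β := β + 1) (by linarith)
    (g := fun x => Complex.exp (Complex.I * (m : ℂ) * (x : ℂ))) (by fun_prop)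
  have key := integral_eq_sub_of_hasDerivAt_of_le Real.pi_pos.le
    (f := fun x => ((Real.sin x ^ (β + 1) : ℝ) : ℂ) *
      Complex.exp (Complex.I * (m : ℂ) * (x : ℂ)))
    (f' := fun x => ((β : ℂ) + 1) * (((Real.sin x ^ β : ℝ) : ℂ) *
        ((Real.cos x : ℂ) * Complex.exp (Complex.I * (m : ℂ) * (x : ℂ)))) +
        (Complex.I * m) * (((Real.sin x ^ (β + 1) : ℝ) : ℂ) *
        Complex.exp (Complex.I * (m : ℂ) * (x : ℂ)))) ?_ ?_ ?_
  · rw [integral_add (hi1.const_mul _) (hi2.const_mul _), intervalIntegral.integral_const_mul,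
      intervalIntegral.integral_const_mul] at key
    simp only [Real.sin_pi, Real.sin_zero, Real.zero_rpow (by linarith : β + 1 ≠ 0),
      Complex.ofReal_zero, zero_mul, sub_zero] at key
    rw [sinPowFourier]
    linear_combination key
  · have : Continuous fun x : ℝ => Real.sin x ^ (β + 1) :=
      Real.continuous_sin.rpow_const fun _ => Or.inr (by linarith)
    fun_prop
  · intro x hx
    have hs := Real.sin_pos_of_pos_of_lt_pi hx.1 hx.2
    have h1 := ((Real.hasDerivAt_sin x).rpow_const (p := β + 1) (Or.inl hs.ne')).ofReal_comp
    have h2 : HasDerivAt (fun x : ℝ => Complex.exp (Complex.I * (m : ℂ) * (x : ℂ)))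
        (Complex.exp (Complex.I * (m : ℂ) * (x : ℂ)) * (Complex.I * (m : ℂ) * 1)) x :=
      ((Complex.ofRealCLM.hasDerivAt (x := x)).const_mul _).cexp
    refine (h1.mul h2).congr_deriv ?_
    rw [add_sub_cancel_right]
    push_cast
    ring
  · exact (hi1.const_mul _).add (hi2.const_mul _)

theorem sinPowFourier_add_two {β : ℝ} (hβ : -1 < β) (m : ℤ) :
    sinPowFourier β (m + 2) * (β + m + 2) = sinPowFourier β m * (m - β) := by
  have hi (n : ℤ) := intervalIntegrable_sin_rpow_mul hβ
    (g := fun x => Complex.exp (Complex.I * (n : ℂ) * (x : ℂ))) (by fun_prop)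
  have e1 (x : ℝ) : Complex.exp (Complex.I * ((m + 2 : ℤ) : ℂ) * (x : ℂ)) =
      Complex.exp (Complex.I * ((m + 1 : ℤ) : ℂ) * (x : ℂ)) * Complex.exp (x * Complex.I) := by
    rw [← Complex.exp_add]; push_cast; ring_nf
  have e2 (x : ℝ) : Complex.exp (Complex.I * (m : ℂ) * (x : ℂ)) =
      Complex.exp (Complex.I * ((m + 1 : ℤ) : ℂ) * (x : ℂ)) * Complex.exp (-x * Complex.I) := by
    rw [← Complex.exp_add]; push_cast; ring_nf
  have hc : ∫ x in (0 : ℝ)..π, ((Real.sin x ^ β : ℝ) : ℂ) *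
        ((Real.cos x : ℂ) * Complex.exp (Complex.I * ((m + 1 : ℤ) : ℂ) * (x : ℂ)))
      = (sinPowFourier β (m + 2) + sinPowFourier β m) / 2 := by
    rw [sinPowFourier, sinPowFourier, ← integral_add (hi _) (hi _), ← intervalIntegral.integral_div]
    congr 1 with x
    rw [e1, e2, Complex.ofReal_cos, Complex.cos]
    ring
  have hs : sinPowFourier (β + 1) (m + 1)
      = (sinPowFourier β (m + 2) - sinPowFourier β m) / (2 * Complex.I) := by
    rw [sinPowFourier, sinPowFourier, sinPowFourier, ← integral_sub (hi _) (hi _), ← intervalIntegral.integral_div]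
    refine integral_congr fun x hx => ?_
    rw [uIcc_of_le Real.pi_pos.le] at hx
    rw [sin_rpow_add_one hβ hx, e1, e2, Complex.ofReal_sin, Complex.sin]
    rw [eq_div_iff (by simp)]
    linear_combination ((Real.sin x ^ β : ℝ) : ℂ) *
      Complex.exp (Complex.I * ((m + 1 : ℤ) : ℂ) * (x : ℂ)) *
      (Complex.exp (-x * Complex.I) - Complex.exp (x * Complex.I)) * Complex.I_sq
  have h := integral_sin_rpow_mul_cos_mul_exp hβ (m + 1)
  rw [hc, hs] at h
  have hI := Complex.I_ne_zero
  field_simp at h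
  push_cast at h
  linear_combination h

theorem sinPowFourier_neg (β : ℝ) (m : ℤ) :
    sinPowFourier β (-m) = (-1) ^ m * sinPowFourier β m := by
  have h := integral_comp_sub_left (a := 0) (b := π) (fun x => ((Real.sin x ^ β : ℝ) : ℂ) *
    Complex.exp (Complex.I * ((-m : ℤ) : ℂ) * (x : ℂ))) π
  rw [sub_self, sub_zero] at h
  rw [sinPowFourier, sinPowFourier, ← intervalIntegral.integral_const_mul, ← h]
  congr 1 with x
  rw [Real.sin_pi_sub]
  have : Complex.exp (Complex.I * ((-m : ℤ) : ℂ) * ((π - x : ℝ) : ℂ)) =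
      (-1) ^ m * Complex.exp (Complex.I * (m : ℂ) * x) := by
    rw [show Complex.I * ((-m : ℤ) : ℂ) * ((π - x : ℝ) : ℂ) =
      ((-m : ℤ) : ℂ) * (π * Complex.I) + Complex.I * (m : ℂ) * x by push_cast; ring,
      Complex.exp_add, Complex.exp_int_mul, Complex.exp_pi_mul_I, zpow_neg,
      ← inv_zpow, inv_neg_one]
  rw [this]
  ring

theorem sinPowFourier_add_two_mul {β : ℝ} (hβ : -1 < β) (m : ℤ) (hm : -2 < β + m)
    (hne : ∀ n : ℕ, (m - β) / 2 ≠ -(n : ℝ)) (n : ℕ) :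
    sinPowFourier β (m + 2 * n) *
        ((Real.Gamma ((m - β) / 2) * Real.Gamma ((m + β) / 2 + 1 + n) : ℝ) : ℂ)
      = sinPowFourier β m *
        ((Real.Gamma ((m - β) / 2 + n) * Real.Gamma ((m + β) / 2 + 1) : ℝ) : ℂ) := by
  induction n with
  | zero => simp
  | succ n ih =>
    have h := sinPowFourier_add_two hβ (m + 2 * n)
    rw [show m + 2 * (n : ℤ) + 2 = m + 2 * ((n + 1 : ℕ) : ℤ) by push_cast; ring] at h
    have h1 : (m - β) / 2 + n ≠ 0 := fun h0 => hne n (by linarith)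
    have h2 : 0 < (m + β) / 2 + 1 + n := by
      have : (0 : ℝ) ≤ n := n.cast_nonneg
      linarith
    rw [show (m - β) / 2 + ((n + 1 : ℕ) : ℝ) = ((m - β) / 2 + n) + 1 by push_cast; ring,
      show (m + β) / 2 + 1 + ((n + 1 : ℕ) : ℝ) = ((m + β) / 2 + 1 + n) + 1 by push_cast; ring,
      Real.Gamma_add_one h1, Real.Gamma_add_one h2.ne']
    push_cast at h ih ⊢
    linear_combination ((Real.Gamma ((m - β) / 2) : ℂ) *
      Real.Gamma ((m + β) / 2 + 1 + n) / 2) * h + (((m : ℂ) - β) / 2 + n) * ih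

theorem sinPowFourier_zero {β : ℝ} (hβ : -1 < β) :
    sinPowFourier β 0 = ((√π * Real.Gamma ((β + 1) / 2) / Real.Gamma (β / 2 + 1) : ℝ) : ℂ) := by
  rw [← integral_sin_rpow hβ, sinPowFourier, ← intervalIntegral.integral_ofReal]
  simp

theorem sinPowFourier_one {β : ℝ} (hβ : -1 < β) :
    sinPowFourier β 1 = Complex.I *
      ((√π * Real.Gamma ((β + 2) / 2) / Real.Gamma ((β + 1) / 2 + 1) : ℝ) : ℂ) := by
  have hc := integral_sin_rpow_mul_cos_mul_exp hβ 0
  have hb : (β : ℂ) + 1 ≠ 0 := by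
    intro h
    have : β + 1 = 0 := by exact_mod_cast h
    linarith
  simp only [Int.cast_zero, mul_zero, neg_zero, zero_mul, Complex.exp_zero, mul_one,
    mul_eq_zero, hb, false_or] at hc
  have hs := sinPowFourier_zero (β := β + 1) (by linarith)
  rw [add_assoc, one_add_one_eq_two] at hs
  have hi1 := intervalIntegrable_sin_rpow_mul hβ (g := fun x => (Real.cos x : ℂ)) (by fun_prop)
  have hi2 := intervalIntegrable_sin_rpow_mul (β := β + 1) (by linarith)
    (g := fun x => Complex.exp (Complex.I * ((0 : ℤ) : ℂ) * (x : ℂ))) (by fun_prop)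
  rw [← hs, ← zero_add (Complex.I * _), ← hc, sinPowFourier, sinPowFourier, ← intervalIntegral.integral_const_mul,
    ← integral_add hi1 (hi2.const_mul _)]
  refine integral_congr fun x hx => ?_
  rw [uIcc_of_le Real.pi_pos.le] at hx
  rw [sin_rpow_add_one hβ hx, Int.cast_one, mul_one, mul_comm Complex.I (x : ℂ),
    Complex.exp_mul_I]
  simp
  ring

theorem sinPowFourier_two_mul {β : ℝ} (hβ : -1 < β) (hne : ∀ n : ℕ, -β / 2 ≠ -(n : ℝ)) (l : ℤ) :
    sinPowFourier β (2 * l) = ((√π * Real.Gamma ((β + 1) / 2) *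
      Real.Gamma (-β / 2 + |(l : ℝ)|) /
        (Real.Gamma (-β / 2) * Real.Gamma (β / 2 + 1 + |(l : ℝ)|)) : ℝ) : ℂ) := by
  have habs : sinPowFourier β (2 * l) = sinPowFourier β (0 + 2 * (l.natAbs : ℤ)) := by
    rcases Int.natAbs_eq l with h | h
    · rw [← h, zero_add]
    · rw [zero_add]
      conv_lhs => rw [h, mul_neg, sinPowFourier_neg, zpow_mul]
      norm_num
  have hl : |(l : ℝ)| = (l.natAbs : ℝ) := by simp
  have h := sinPowFourier_add_two_mul hβ 0 (by push_cast; linarith)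
    (by simpa using hne) l.natAbs
  rw [← habs, sinPowFourier_zero hβ, ← hl] at h
  simp only [Int.cast_zero, zero_sub, zero_add] at h
  have h1 : Real.Gamma (-β / 2) ≠ 0 := Real.Gamma_ne_zero hne
  have h2 : Real.Gamma (β / 2 + 1) ≠ 0 := (Real.Gamma_pos_of_pos (by linarith)).ne'
  have h3 : Real.Gamma (β / 2 + 1 + |(l : ℝ)|) ≠ 0 :=
    (Real.Gamma_pos_of_pos (by linarith [abs_nonneg (l : ℝ)])).ne'
  have h4 : ((Real.Gamma (-β / 2) * Real.Gamma (β / 2 + 1 + |(l : ℝ)|) : ℝ) : ℂ) ≠ 0 :=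
    Complex.ofReal_ne_zero.2 (mul_ne_zero h1 h3)
  rw [Complex.ofReal_div, eq_div_iff h4, h, ← Complex.ofReal_mul]
  congr 1
  generalize Real.Gamma (β / 2 + 1) = G at h2 ⊢
  field_simp

theorem sinPowFourier_odd {β : ℝ} (hβ : -1 < β) (hne : ∀ n : ℕ, (1 - β) / 2 ≠ -(n : ℝ))
    {m : ℤ} (hm : Odd m) :
    sinPowFourier β m = Complex.I * (Int.sign m : ℂ) * ((√π * Real.Gamma ((β + 2) / 2) *
      Real.Gamma (-β / 2 + |(m : ℝ)| / 2) /
        (Real.Gamma ((1 - β) / 2) * Real.Gamma (β / 2 + 1 + |(m : ℝ)| / 2)) : ℝ) : ℂ) := by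
  obtain ⟨n, hn⟩ : ∃ n : ℕ, (m.natAbs : ℤ) = 1 + 2 * n := by
    obtain ⟨n, hn⟩ := Int.natAbs_odd.2 hm
    exact ⟨n, by omega⟩
  have habs : sinPowFourier β m = (Int.sign m : ℂ) * sinPowFourier β (1 + 2 * (n : ℤ)) := by
    rw [← hn]
    rcases Int.natAbs_eq m with h | h
    · have : m.sign = 1 := Int.sign_eq_one_of_pos (by omega)
      rw [← h, this]
      simp
    · have : m.sign = -1 := Int.sign_eq_neg_one_of_neg (by omega)
      rw [this]
      conv_lhs => rw [h, sinPowFourier_neg, Odd.neg_one_zpow (Int.natAbs_odd.2 hm).natCast]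
      simp
  have hl : |(m : ℝ)| = 1 + 2 * (n : ℝ) := by
    rw [← Int.cast_abs, Int.abs_eq_natAbs, hn]
    push_cast
    ring
  have h := sinPowFourier_add_two_mul hβ 1 (by push_cast; linarith)
    (by simpa using hne) n
  rw [sinPowFourier_one hβ] at h
  have e1 : -β / 2 + |(m : ℝ)| / 2 = (1 - β) / 2 + n := by rw [hl]; ring
  have e2 : β / 2 + 1 + |(m : ℝ)| / 2 = (1 + β) / 2 + 1 + n := by rw [hl]; ring
  rw [e1, e2, habs]
  simp only [Int.cast_one] at h
  rw [add_comm β 1] at h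
  have h1 : Real.Gamma ((1 - β) / 2) ≠ 0 := Real.Gamma_ne_zero hne
  have h2 : Real.Gamma ((1 + β) / 2 + 1) ≠ 0 := (Real.Gamma_pos_of_pos (by linarith)).ne'
  have h3 : Real.Gamma ((1 + β) / 2 + 1 + n) ≠ 0 :=
    (Real.Gamma_pos_of_pos (by linarith [n.cast_nonneg (α := ℝ)])).ne'
  have h4 : ((Real.Gamma ((1 - β) / 2) * Real.Gamma ((1 + β) / 2 + 1 + n) : ℝ) : ℂ) ≠ 0 :=
    Complex.ofReal_ne_zero.2 (mul_ne_zero h1 h3)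
  rw [mul_comm Complex.I, mul_assoc]
  congr 1
  rw [Complex.ofReal_div, ← mul_div_assoc, eq_div_iff h4, h, mul_assoc, ← Complex.ofReal_mul]
  congr 2
  generalize Real.Gamma ((1 + β) / 2 + 1) = G at h2 ⊢
  field_simp

theorem intervalIntegrable_abs_sin_rpow {p : ℝ} (hp : -1 < p) (a b : ℝ) :
    IntervalIntegrable (fun x => |Real.sin x| ^ p) volume a b := by
  refine Function.Periodic.intervalIntegrable₀ (T := π) (fun x => ?_) Real.pi_ne_zero ?_ a b
  · simp [Real.sin_add_pi]
  · refine (intervalIntegrable_sin_rpow hp).congr fun x hx => ?_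
    rw [uIoc_of_le Real.pi_pos.le] at hx
    rw [abs_of_nonneg (Real.sin_nonneg_of_mem_Icc (Ioc_subset_Icc_self hx))]

theorem intervalIntegrable_abs_sin_sub_rpow {p : ℝ} (hp : -1 < p) (c a b : ℝ) :
    IntervalIntegrable (fun x => |Real.sin (x - c)| ^ p) volume a b := by
  simpa using (intervalIntegrable_abs_sin_rpow hp (a - c) (b - c)).comp_sub_right c

theorem integral_exp_mul_abs_sin_sub_rpow (p : ℝ) (l : ℤ) (c : ℝ) :
    ∫ s in (0 : ℝ)..π, Complex.exp (-2 * Complex.I * (l : ℂ) * (s : ℂ)) *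
        ((|Real.sin (s - c)| ^ p : ℝ) : ℂ)
      = Complex.exp (-2 * Complex.I * (l : ℂ) * (c : ℂ)) * sinPowFourier p (2 * -l) := by
  set F : ℝ → ℂ := fun u => ((|Real.sin u| ^ p : ℝ) : ℂ) *
    Complex.exp (Complex.I * ((2 * -l : ℤ) : ℂ) * (u : ℂ)) with hF
  have hper : Function.Periodic F π := by
    intro u
    simp only [hF]
    rw [Real.sin_add_pi, abs_neg]
    congr 1
    rw [show Complex.I * ((2 * -l : ℤ) : ℂ) * ((u + π : ℝ) : ℂ) =
      Complex.I * ((2 * -l : ℤ) : ℂ) * u + ((-l : ℤ) : ℂ) * (2 * π * Complex.I) by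
        push_cast; ring, Complex.exp_add, Complex.exp_int_mul_two_pi_mul_I, mul_one]
  have h1 : sinPowFourier p (2 * -l) = ∫ u in (0 : ℝ)..π, F u := by
    refine integral_congr fun x hx => ?_
    rw [uIcc_of_le Real.pi_pos.le] at hx
    simp only [hF]
    rw [abs_of_nonneg (Real.sin_nonneg_of_mem_Icc hx)]
  have h2 := hper.intervalIntegral_add_eq (-c) 0
  rw [zero_add, ← h1, show -c = 0 - c by ring, show 0 - c + π = π - c by ring,
    ← integral_comp_sub_right F c] at h2
  rw [← h2, ← intervalIntegral.integral_const_mul]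
  congr 1 with s
  simp only [hF]
  rw [mul_left_comm, ← Complex.exp_add, mul_comm]
  congr 2
  push_cast
  ring

theorem integral_exp_mul_integral_mul_abs_sin_sub_rpow {p : ℝ} (hp : -1 < p) (l : ℤ)
    {h : ℝ → ℂ} (hh : Continuous h) :
    ∫ s in (0 : ℝ)..π, Complex.exp (-2 * Complex.I * (l : ℂ) * (s : ℂ)) *
        ∫ η in (0 : ℝ)..π, h η * ((|Real.sin (s - η)| ^ p : ℝ) : ℂ)
      = sinPowFourier p (2 * -l) *
        ∫ η in (0 : ℝ)..π, h η * Complex.exp (-2 * Complex.I * (l : ℂ) * (η : ℂ)) := by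
  simp only [← intervalIntegral.integral_const_mul]
  rw [intervalIntegral_intervalIntegral_swap]
  · congr 1 with η
    rw [mul_left_comm, mul_comm (sinPowFourier _ _), ← integral_exp_mul_abs_sin_sub_rpow,
      ← intervalIntegral.integral_const_mul]
    congr 1 with s
    ring
  · rw [uIoc_of_le Real.pi_pos.le, IntegrableOn, Measure.volume_eq_prod, ← Measure.prod_restrict]
    have hmeas : AEStronglyMeasurable (Function.uncurry fun s η : ℝ =>
        Complex.exp (-2 * Complex.I * (l : ℂ) * (s : ℂ)) *
          (h η * ((|Real.sin (s - η)| ^ p : ℝ) : ℂ)))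
        ((volume.restrict (Ioc 0 π)).prod (volume.restrict (Ioc 0 π))) := by
      have := hh.measurable
      apply Measurable.aestronglyMeasurable
      unfold Function.uncurry
      fun_prop
    rw [integrable_prod_iff' hmeas]
    have hint (η : ℝ) : IntervalIntegrable (fun s : ℝ =>
        Complex.exp (-2 * Complex.I * (l : ℂ) * (s : ℂ)) *
          (h η * ((|Real.sin (s - η)| ^ p : ℝ) : ℂ))) volume 0 π := by
      have hi := intervalIntegrable_abs_sin_sub_rpow hp η 0 π
      have hi' : IntervalIntegrable (fun s => ((|Real.sin (s - η)| ^ p : ℝ) : ℂ)) volume 0 π :=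
        ⟨hi.1.ofReal, hi.2.ofReal⟩
      exact (hi'.const_mul (h η)).continuousOn_mul (by fun_prop)
    refine ⟨Eventually.of_forall fun η => (hint η).1, ?_⟩
    have hnorm (η : ℝ) : ∫ s in Ioc 0 π, ‖Complex.exp (-2 * Complex.I * (l : ℂ) * (s : ℂ)) *
          (h η * ((|Real.sin (s - η)| ^ p : ℝ) : ℂ))‖
        = ‖h η‖ * ‖sinPowFourier p (2 * -0)‖ := by
      have h1 (s : ℝ) : ‖Complex.exp (-2 * Complex.I * (l : ℂ) * (s : ℂ))‖ = 1 := by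
        rw [show -2 * Complex.I * (l : ℂ) * (s : ℂ) = ((-2 * l * s : ℝ) : ℂ) * Complex.I by
          push_cast; ring, Complex.norm_exp_ofReal_mul_I]
      have h2 := integral_exp_mul_abs_sin_sub_rpow p 0 η
      simp only [Int.cast_zero, mul_zero, zero_mul, Complex.exp_zero, one_mul,
        intervalIntegral.integral_ofReal] at h2
      have h3 : 0 ≤ ∫ s in (0 : ℝ)..π, |Real.sin (s - η)| ^ p :=
        intervalIntegral.integral_nonneg Real.pi_pos.le fun s _ => by positivity
      rw [← h2, Complex.norm_real, Real.norm_of_nonneg h3,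
        ← intervalIntegral.integral_const_mul, integral_of_le Real.pi_pos.le]
      congr 1 with s
      rw [norm_mul, h1, one_mul, norm_mul, Complex.norm_real, Real.norm_of_nonneg (by positivity)]
    simp only [Function.uncurry_apply_pair, hnorm]
    exact ((hh.norm.mul continuous_const).intervalIntegrable 0 π).1

theorem integral_sin_rpow_mul_affine_mul_exp {α : ℝ} (hα : -1 < α) (k l : ℤ) :
    ((α : ℂ) + 1) * ∫ η in (0 : ℝ)..π, ((Real.sin η ^ α : ℝ) : ℂ)
          * (-(k : ℂ) ^ 2 * (Real.sin η : ℂ) + 2 * Complex.I * (k : ℂ) * (Real.cos η : ℂ))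
          * Complex.exp (Complex.I * (k : ℂ) * (η : ℂ))
          * Complex.exp (-2 * Complex.I * (l : ℂ) * (η : ℂ))
      = ((1 - α) * (k : ℂ) ^ 2 - 4 * k * l) * sinPowFourier (α + 1) (k - 2 * l) := by
  have hi1 := intervalIntegrable_sin_rpow_mul hα
    (g := fun x => (Real.cos x : ℂ) *
      Complex.exp (Complex.I * ((k - 2 * l : ℤ) : ℂ) * (x : ℂ))) (by fun_prop)
  have hi2 := intervalIntegrable_sin_rpow_mul (β := α + 1) (by linarith)
    (g := fun x => Complex.exp (Complex.I * ((k - 2 * l : ℤ) : ℂ) * (x : ℂ))) (by fun_prop)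
  have hparts := integral_sin_rpow_mul_cos_mul_exp hα (k - 2 * l)
  have hsplit : ∫ η in (0 : ℝ)..π, ((Real.sin η ^ α : ℝ) : ℂ)
          * (-(k : ℂ) ^ 2 * (Real.sin η : ℂ) + 2 * Complex.I * (k : ℂ) * (Real.cos η : ℂ))
          * Complex.exp (Complex.I * (k : ℂ) * (η : ℂ))
          * Complex.exp (-2 * Complex.I * (l : ℂ) * (η : ℂ))
      = -(k : ℂ) ^ 2 * sinPowFourier (α + 1) (k - 2 * l) + 2 * Complex.I * k *
        ∫ x in (0 : ℝ)..π, ((Real.sin x ^ α : ℝ) : ℂ) * ((Real.cos x : ℂ) *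
          Complex.exp (Complex.I * ((k - 2 * l : ℤ) : ℂ) * (x : ℂ))) := by
    rw [sinPowFourier, ← intervalIntegral.integral_const_mul,
      ← intervalIntegral.integral_const_mul,
      ← integral_add (hi2.const_mul _) (hi1.const_mul _)]
    refine integral_congr fun x hx => ?_
    rw [uIcc_of_le Real.pi_pos.le] at hx
    rw [sin_rpow_add_one hα hx, mul_assoc (_ * _) (Complex.exp _), ← Complex.exp_add,
      show Complex.I * (k : ℂ) * (x : ℂ) + -2 * Complex.I * (l : ℂ) * (x : ℂ) =
        Complex.I * ((k - 2 * l : ℤ) : ℂ) * (x : ℂ) by push_cast; ring]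
    ring
  rw [hsplit, mul_add, mul_left_comm _ (2 * Complex.I * (k : ℂ)), hparts]
  push_cast
  linear_combination (-2 * (k : ℂ) * (k - 2 * l) * sinPowFourier (α + 1) (k - 2 * l)) *
    Complex.I_sq

theorem gamma_constants_identity {α : ℝ} (h0 : 0 < α) (h1 : α ≠ 1) :
    π * α * (1 - α) * (α + 1) * (Real.Gamma ((α - 1) / 2) * Real.Gamma (-α / 2)) =
      8 * (√π * Real.Gamma (1 - α / 2)) * (√π * Real.Gamma ((α + 3) / 2)) := by
  have e1 : Real.Gamma (1 - α / 2) = (-α / 2) * Real.Gamma (-α / 2) := by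
    rw [← Real.Gamma_add_one (by linarith)]; ring_nf
  have h1' : (α - 1) / 2 ≠ 0 := fun h => h1 (by linarith)
  have e2 : Real.Gamma ((α + 3) / 2) =
      ((α - 1) / 2 + 1) * ((α - 1) / 2 * Real.Gamma ((α - 1) / 2)) := by
    rw [← Real.Gamma_add_one h1', ← Real.Gamma_add_one (by linarith)]; ring_nf
  rw [e1, e2]
  have := Real.mul_self_sqrt Real.pi_pos.le
  linear_combination (α * (1 - α) * (α + 1) *
    (Real.Gamma ((α - 1) / 2) * Real.Gamma (-α / 2))) * (-1) * this

open MeasureTheory Filter Set Real intervalIntegral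

/-- The Fourier coefficient d_{k,l} for odd k (equations (25)–(27) and (34) of the paper). -/
theorem stmt_15 (α : ℝ) (hα : α ∈ Set.Ioo (0:ℝ) 1 ∪ Set.Ioo (1:ℝ) 2)
    (k : ℤ) (hk : Odd k) (l : ℤ) :
    (∀ s ∈ Set.Ioo 0 π,
      IntervalIntegrable (fun η : ℝ =>
          ((Real.sin η ^ α : ℝ) : ℂ)
            * (-(k : ℂ) ^ 2 * (Real.sin η : ℂ) + 2 * Complex.I * (k : ℂ) * (Real.cos η : ℂ))
            * Complex.exp (Complex.I * (k : ℂ) * (η : ℂ))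
            * ((|Real.sin (s - η)| ^ (1 - α) : ℝ) : ℂ))
        MeasureTheory.volume 0 π) ∧
    (1 / (π : ℂ)) * ∫ s in (0:ℝ)..π,
        Complex.exp (-2 * Complex.I * (l : ℂ) * (s : ℂ))
          * ∫ η in (0:ℝ)..π,
              ((Real.sin η ^ α : ℝ) : ℂ)
                * (-(k : ℂ) ^ 2 * (Real.sin η : ℂ) + 2 * Complex.I * (k : ℂ) * (Real.cos η : ℂ))
                * Complex.exp (Complex.I * (k : ℂ) * (η : ℂ))
                * ((|Real.sin (s - η)| ^ (1 - α) : ℝ) : ℂ)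
      = Complex.I * (Int.sign (k - 2 * l) : ℂ) / 8
          * ((α * (1 - α) * ((1 - α) * (k : ℝ) ^ 2 - 4 * (k : ℝ) * (l : ℝ))
              * (Real.Gamma ((α - 1) / 2 + |(l : ℝ)|)
                  * Real.Gamma ((-1 - α) / 2 + |(k : ℝ) - 2 * (l : ℝ)| / 2)
                / (Real.Gamma ((3 - α) / 2 + |(l : ℝ)|)
                  * Real.Gamma ((3 + α) / 2 + |(k : ℝ) - 2 * (l : ℝ)| / 2))) : ℝ) : ℂ) := by
  have h0 : 0 < α := by rcases hα with h | h <;> linarith [h.1]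
  have h1 : α ≠ 1 := by rcases hα with h | h <;> [exact h.2.ne; exact h.1.ne']
  have h2 : α < 2 := by rcases hα with h | h <;> linarith [h.2]
  have hcont : Continuous fun η : ℝ => ((Real.sin η ^ α : ℝ) : ℂ)
      * (-(k : ℂ) ^ 2 * (Real.sin η : ℂ) + 2 * Complex.I * (k : ℂ) * (Real.cos η : ℂ))
      * Complex.exp (Complex.I * (k : ℂ) * (η : ℂ)) := by
    have : Continuous fun x : ℝ => Real.sin x ^ α :=
      Real.continuous_sin.rpow_const fun _ => Or.inr h0.le
    fun_prop
  refine ⟨fun s _ => ?_, ?_⟩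
  · have hi := intervalIntegrable_abs_sin_sub_rpow (p := 1 - α) (by linarith) s 0 π
    have hi' : IntervalIntegrable (fun η => ((|Real.sin (s - η)| ^ (1 - α) : ℝ) : ℂ))
        volume 0 π := by
      simp only [← neg_sub s, Real.sin_neg, abs_neg] at hi
      exact ⟨hi.1.ofReal, hi.2.ofReal⟩
    exact hi'.continuousOn_mul hcont.continuousOn
  · rw [integral_exp_mul_integral_mul_abs_sin_sub_rpow (by linarith) l hcont]
    have hα1 : (α : ℂ) + 1 ≠ 0 := by
      rw [← Complex.ofReal_one, ← Complex.ofReal_add, Complex.ofReal_ne_zero]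
      linarith
    have hmodd : Odd (k - 2 * l) := hk.sub_even (even_two_mul l)
    have hA (n : ℕ) : -(1 - α) / 2 ≠ -(n : ℝ) := by
      intro h
      rcases n with _ | n
      · exact h1 (by simp at h; linarith)
      · push_cast at h
        linarith [n.cast_nonneg (α := ℝ)]
    have hB (n : ℕ) : (1 - (α + 1)) / 2 ≠ -(n : ℝ) := by
      intro h
      have h3 : (0 : ℝ) < n := by linarith
      have h4 : (n : ℝ) < 1 := by linarith
      norm_cast at h3 h4
      omega
    rw [eq_div_of_mul_eq hα1 ((mul_comm _ _).trans
      (integral_sin_rpow_mul_affine_mul_exp (by linarith) k l)),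
      sinPowFourier_two_mul (by linarith) hA, sinPowFourier_odd (by linarith) hB hmodd]
    have hc := gamma_constants_identity h0 h1
    have g1 : Real.Gamma ((α - 1) / 2) ≠ 0 := by
      have := Real.Gamma_ne_zero hA
      rwa [neg_sub] at this
    have g2 : Real.Gamma (-α / 2) ≠ 0 := by
      have := Real.Gamma_ne_zero hB
      rwa [show (1 - (α + 1)) / 2 = -α / 2 by ring] at this
    have g3 : Real.Gamma ((3 - α) / 2 + |(l : ℝ)|) ≠ 0 :=
      (Real.Gamma_pos_of_pos (by linarith [abs_nonneg (l : ℝ)])).ne'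
    have g4 : Real.Gamma ((3 + α) / 2 + |(k : ℝ) - 2 * (l : ℝ)| / 2) ≠ 0 :=
      (Real.Gamma_pos_of_pos (by linarith [abs_nonneg ((k : ℝ) - 2 * (l : ℝ))])).ne'
    have ek : ((k - 2 * l : ℤ) : ℝ) = (k : ℝ) - 2 * (l : ℝ) := by push_cast; ring
    have el : |((-l : ℤ) : ℝ)| = |(l : ℝ)| := by push_cast; exact abs_neg _
    rw [ek, el, show (1 - α + 1) / 2 = 1 - α / 2 by ring, show -(1 - α) / 2 = (α - 1) / 2 by ring,
      show (1 - α) / 2 + 1 = (3 - α) / 2 by ring, show (α + 1 + 2) / 2 = (α + 3) / 2 by ring,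
      show -(α + 1) / 2 = (-1 - α) / 2 by ring, show (1 - (α + 1)) / 2 = -α / 2 by ring,
      show (α + 1) / 2 + 1 = (3 + α) / 2 by ring]
    generalize Real.Gamma ((3 - α) / 2 + |(l : ℝ)|) = G3 at *
    generalize Real.Gamma ((3 + α) / 2 + |(k : ℝ) - 2 * (l : ℝ)| / 2) = G4 at *
    generalize Real.Gamma ((α - 1) / 2 + |(l : ℝ)|) = G5 at *
    generalize Real.Gamma ((-1 - α) / 2 + |(k : ℝ) - 2 * (l : ℝ)| / 2) = G6 at *
    generalize Real.Gamma (1 - α / 2) = G7 at *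
    generalize Real.Gamma ((α + 3) / 2) = G8 at *
    generalize Real.Gamma ((α - 1) / 2) = G1 at *
    generalize Real.Gamma (-α / 2) = G2 at *
    have key : 1 / π * ((√π * G7 * G5 / (G1 * G3)) * (((1 - α) * (k : ℝ) ^ 2 - 4 * k * l) *
        (√π * G8 * G6 / (G2 * G4)) / (α + 1))) = 1 / 8 * (α * (1 - α) *
          ((1 - α) * (k : ℝ) ^ 2 - 4 * (k : ℝ) * (l : ℝ)) * (G5 * G6 / (G3 * G4))) := by
      have hp := Real.pi_ne_zero
      have h5 : α + 1 ≠ 0 := by linarith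
      generalize √π = r at *
      field_simp
      linear_combination (-(G5 * G6)) * ((1 - α) * (k : ℝ) ^ 2 - 4 * (k : ℝ) * (l : ℝ)) * hc
    have key' := congrArg (fun x : ℝ => (x : ℂ)) key
    push_cast at key' ⊢
    linear_combination (Complex.I * ((k - 2 * l).sign : ℂ)) * key'
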